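/- Let n ∈ ℕ⁺ and let i be an integer with 0 ≤ i ≤ n − 1. Then g(n, 2ⁿ − i) = 2^{n−1}; that is, the minimum over all union-closed families 𝒮 ⊆ 2^{[n]} with |𝒮| = 2ⁿ − i of the quantity max_{e ∈ [n]} |{A ∈ 𝒮 : e ∈ A}| equals 2^{n−1}. -/

import Mathlib

/-- A family of subsets of `[n]` (modeled as `Fin n`) is union-closed if it is
closed under pairwise unions. -/
def UnionClosed {n : ℕ} (𝒮 : Finset (Finset (Fin n))) : Prop :=
  ∀ A ∈ 𝒮, ∀ B ∈ 𝒮, A ∪ B ∈ 𝒮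

/-- The maximum frequency of an element of `[n]` in the family `𝒮`. -/
def maxFreq {n : ℕ} (𝒮 : Finset (Finset (Fin n))) : ℕ :=
  Finset.univ.sup (fun e : Fin n => (𝒮.filter (fun A => e ∈ A)).card)

/-- Exactly half of the subsets of `[n]` contain a given element. -/
lemma card_filter_mem_eq {n : ℕ} (e : Fin n) :
    (Finset.univ.filter (fun A : Finset (Fin n) => e ∈ A)).card = 2 ^ (n - 1) := by
  have h : ((Finset.univ.erase e).powerset).card = 2 ^ (n - 1) := by
    rw [Finset.card_powerset, Finset.card_erase_of_mem (Finset.mem_univ e), Finset.card_univ,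
      Fintype.card_fin]
  rw [← h]
  refine Finset.card_nbij' (fun A => A.erase e) (fun A => insert e A) ?_ ?_ ?_ ?_
  · intro A _
    simp
  · intro A _
    simp
  · intro A hA
    exact Finset.insert_erase (by simpa using hA)
  · intro A hA
    have hA' : A ⊆ Finset.univ.erase e := Finset.mem_powerset.1 hA
    exact Finset.erase_insert fun he => Finset.notMem_erase e _ (hA' he)

lemma maxFreq_le {n : ℕ} (𝒮 : Finset (Finset (Fin n))) : maxFreq 𝒮 ≤ 2 ^ (n - 1) :=
  Finset.sup_le fun e _ => (Finset.card_le_card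
    (Finset.filter_subset_filter _ (Finset.subset_univ 𝒮))).trans (card_filter_mem_eq e).le

/-- If a set missing from a union-closed family contains `x`, then some missing set is either
`{x}` or a pair `{x, y}` with `{y}` missing. -/
lemma UnionClosed.exists_notMem_pair {n : ℕ} {𝒮 : Finset (Finset (Fin n))} (h𝒮 : UnionClosed 𝒮)
    {x : Fin n} {A : Finset (Fin n)} (hA : A ∉ 𝒮) (hx : x ∈ A) :
    ∃ y, {x, y} ∉ 𝒮 ∧ {y} ∉ 𝒮 := by
  induction A using Finset.strongInduction with
  | H A ih =>
    by_cases hy : ∃ y ∈ A, y ≠ x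
    · obtain ⟨y, hyA, hyx⟩ := hy
      have hunion : {x, y} ∪ A.erase y = A := by grind
      by_cases hpair : {x, y} ∈ 𝒮
      · have herase : A.erase y ∉ 𝒮 := fun h => hA (hunion ▸ h𝒮 _ hpair _ h)
        exact ih _ (Finset.erase_ssubset hyA) herase (by grind)
      · by_cases hsingle : {y} ∈ 𝒮
        · have hxs : {x} ∉ 𝒮 := fun h => hpair (h𝒮 _ h _ hsingle)
          exact ⟨x, by simpa using hxs, hxs⟩
        · exact ⟨y, hpair, hsingle⟩
    · have hAx : A = {x} := by grind
      subst hAx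
      exact ⟨x, by simpa using hA, hA⟩

/-- If every element of `[n]` lies in a set missing from a union-closed family, then at least `n`
sets are missing. -/
lemma UnionClosed.le_card_compl {n : ℕ} {𝒮 : Finset (Finset (Fin n))} (h𝒮 : UnionClosed 𝒮)
    (hcover : ∀ x, ∃ A ∉ 𝒮, x ∈ A) : n ≤ (𝒮ᶜ).card := by
  have hex : ∀ x : Fin n, ∃ y, {x, y} ∉ 𝒮 ∧ {y} ∉ 𝒮 ∧ ({x} ∉ 𝒮 → y = x) := by
    intro x
    by_cases hx : {x} ∈ 𝒮
    · obtain ⟨A, hA, hxA⟩ := hcover x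
      obtain ⟨y, hxy, hy⟩ := h𝒮.exists_notMem_pair hA hxA
      exact ⟨y, hxy, hy, fun h => absurd hx h⟩
    · exact ⟨x, by simpa using hx, hx, fun _ => rfl⟩
  choose f hpair hsingle hself using hex
  have hinj : Function.Injective (fun x => ({x, f x} : Finset (Fin n))) := by
    intro a b hab
    have hab' : ({a, f a} : Finset (Fin n)) = {b, f b} := hab
    have ha : a = b ∨ a = f b := by
      have : a ∈ ({b, f b} : Finset (Fin n)) := hab' ▸ by simp
      simpa using this
    have hb : b = a ∨ b = f a := by
      have : b ∈ ({a, f a} : Finset (Fin n)) := hab' ▸ by simp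
      simpa using this
    rcases ha with h | h
    · exact h
    rcases hb with h' | h'
    · exact h'.symm
    have : {a} ∉ 𝒮 := h ▸ hsingle b
    rw [h', hself a this]
  calc n = (Finset.univ : Finset (Fin n)).card := by simp
    _ ≤ (𝒮ᶜ).card := Finset.card_le_card_of_injOn _
        (fun x _ => by simpa using hpair x) hinj.injOn

lemma UnionClosed.two_pow_le_maxFreq {n : ℕ} {𝒮 : Finset (Finset (Fin n))} (h𝒮 : UnionClosed 𝒮)
    (hcard : (𝒮ᶜ).card < n) : 2 ^ (n - 1) ≤ maxFreq 𝒮 := by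
  obtain ⟨e, he⟩ : ∃ e, ∀ A, e ∈ A → A ∈ 𝒮 := by
    by_contra! h
    exact hcard.not_ge (h𝒮.le_card_compl fun x => (h x).imp fun A hA => ⟨hA.2, hA.1⟩)
  rw [← card_filter_mem_eq e]
  refine le_trans (Finset.card_le_card fun A hA => ?_)
    (Finset.le_sup (f := fun e => (𝒮.filter (fun A => e ∈ A)).card) (Finset.mem_univ e))
  have heA : e ∈ A := by simpa using hA
  exact Finset.mem_filter.2 ⟨he A heA, heA⟩

/-- Removing singletons from the power set leaves a union-closed family. -/
lemma unionClosed_compl_image_singleton {n : ℕ} (T : Finset (Fin n)) :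
    UnionClosed (T.image fun x => ({x} : Finset (Fin n)))ᶜ := by
  intro A hA B hB
  simp only [Finset.mem_compl, Finset.mem_image, not_exists, not_and] at hA hB ⊢
  intro x hx hAB
  have hAs : A ⊆ {x} := hAB ▸ Finset.subset_union_left
  have hBs : B ⊆ {x} := hAB ▸ Finset.subset_union_right
  rcases Finset.subset_singleton_iff.1 hAs with rfl | rfl
  · exact hB x hx (by simpa using hAB)
  · exact hA x hx rfl

/-- `g(n, 2^n - i) = 2^(n-1)` for `0 ≤ i ≤ n - 1`: the number `2^(n-1)` is the
minimum, over all union-closed families `𝒮 ⊆ 2^{[n]}` with `|𝒮| = 2^n - i`, of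
the maximum frequency of an element. -/
theorem g_eq_half_powerset
    (n i : ℕ) (hn : 0 < n) (hi : i ≤ n - 1) :
    IsLeast {k : ℕ | ∃ 𝒮 : Finset (Finset (Fin n)),
        UnionClosed 𝒮 ∧ 𝒮.card = 2 ^ n - i ∧ maxFreq 𝒮 = k}
      (2 ^ (n - 1)) := by
  constructor
  · obtain ⟨T, -, hT⟩ := Finset.exists_subset_card_eq
      (s := (Finset.univ : Finset (Fin n))) (n := i) (by rw [Finset.card_fin]; omega)
    have himage : (T.image fun x => ({x} : Finset (Fin n))).card = i := by
      rw [Finset.card_image_of_injective _ Finset.singleton_injective, hT]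
    have hclosed := unionClosed_compl_image_singleton T
    refine ⟨_, hclosed, ?_, le_antisymm (maxFreq_le _) (hclosed.two_pow_le_maxFreq ?_)⟩
    · rw [Finset.card_compl, himage, Fintype.card_finset, Fintype.card_fin]
    · rw [compl_compl, himage]
      omega
  · rintro k ⟨𝒮, h𝒮, hcard, rfl⟩
    refine h𝒮.two_pow_le_maxFreq ?_
    rw [Finset.card_compl, hcard, Fintype.card_finset, Fintype.card_fin]
    have := Nat.lt_two_pow_self (n := n)
    omega
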